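/- Let X ~ SN₂((θ,θ), R) with θ > 0 and ρ ∈ (-1,1). Then the lower tail dependence function λ_L(u) = P(X₁ ≤ F₁⁻¹(u) | X₂ ≤ F₂⁻¹(u)) satisfies λ_L(u) ~ u^{β²} · (α³/(πλ⁴β(1+β²)²)) √(2/π) (2πλ)^{1+β²} ((1+λ²)/2)^{3/2} (-log u)^{β² - 1/2} as u → 0⁺, where λ = θ(1+ρ)/√(1+θ²(1-ρ²)), α = θ(1+ρ)/√(1+2θ²(1+ρ)), β = √((1-ρ)(1+2θ²(1+ρ))/(1+ρ)). -/

import Mathlib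

open Real MeasureTheory Filter Set

noncomputable def stdNormalPdf (t : ℝ) : ℝ := (Real.sqrt (2 * π))⁻¹ * Real.exp (-t ^ 2 / 2)

noncomputable def stdNormalCdf (z : ℝ) : ℝ := ∫ t in Set.Iic z, stdNormalPdf t

noncomputable def biNormalPdf (r : ℝ) (p : ℝ × ℝ) : ℝ :=
  (2 * π * Real.sqrt (1 - r ^ 2))⁻¹ *
    Real.exp (-(p.1 ^ 2 - 2 * r * p.1 * p.2 + p.2 ^ 2) / (2 * (1 - r ^ 2)))

noncomputable def biSkewNormalPdf (θ ρ : ℝ) (p : ℝ × ℝ) : ℝ :=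
  2 * biNormalPdf ρ p * stdNormalCdf (θ * p.1 + θ * p.2)

/-- The common marginal cdf of the equi-skew SN₂, i.e. the univariate SN(λ) cdf. -/
noncomputable def skewNormalCdf (l z : ℝ) : ℝ :=
  ∫ t in Set.Iic z, 2 * stdNormalPdf t * stdNormalCdf (l * t)

/-! ### Rescaling and Laplace-type limits -/

lemma setIntegral_eq_inv_mul_setIntegral_rescale {E : Type*} [NormedAddCommGroup E]
    [NormedSpace ℝ E] [MeasurableSpace E] [BorelSpace E] [FiniteDimensional ℝ E] (μ : Measure E)
    [μ.IsAddHaarMeasure] {S : Set E} (hS : MeasurableSet S) (f : E → ℝ) (v : E) {t : ℝ}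
    (ht : 0 < t) :
    ∫ p in S, f p ∂μ = (t ^ Module.finrank ℝ E)⁻¹ *
      ∫ p in (fun p => v - t⁻¹ • p) ⁻¹' S, f (v - t⁻¹ • p) ∂μ := by
  have hmeas : Measurable fun p : E => v - t⁻¹ • p := by fun_prop
  have h1 := integral_sub_left_eq_self (S.indicator f) μ v
  have h2 := Measure.integral_comp_smul μ (fun p => S.indicator f (v - p)) t⁻¹
  rw [← integral_indicator hS, ← h1, ← integral_indicator (hmeas hS)]
  have h3 : (fun p => ((fun p => v - t⁻¹ • p) ⁻¹' S).indicator (fun p => f (v - t⁻¹ • p)) p) =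
      fun p => S.indicator f (v - t⁻¹ • p) := by
    ext p
    simp only [Set.indicator, mem_preimage]
    rfl
  rw [h3, h2, abs_of_pos (by positivity), smul_eq_mul, inv_pow, inv_inv, ← mul_assoc,
    inv_mul_cancel₀ (by positivity), one_mul]

lemma tendsto_setIntegral_exp_neg_mul {E : Type*} [MeasurableSpace E] {μ : Measure E} {T : Set E}
    (hT : MeasurableSet T) {ℓ q : E → ℝ} {w : ℝ → E → ℝ} {W : ℝ} (hℓ : Measurable ℓ)
    (hq : Measurable q) (hw : ∀ t, Measurable (w t)) (hq0 : ∀ p ∈ T, 0 ≤ q p)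
    (hwb : ∀ t > 0, ∀ p ∈ T, |w t p| ≤ W)
    (hwlim : ∀ p ∈ T, Tendsto (fun t => w t p) atTop (nhds W))
    (hint : IntegrableOn (fun p => Real.exp (-ℓ p)) T μ) :
    Tendsto (fun t : ℝ => ∫ p in T, Real.exp (-ℓ p - q p / t ^ 2) * w t p ∂μ) atTop
      (nhds (∫ p in T, Real.exp (-ℓ p) * W ∂μ)) := by
  refine tendsto_integral_filter_of_dominated_convergence (fun p => Real.exp (-ℓ p) * W)
    (Eventually.of_forall fun t => ?_) ?_ (hint.mul_const W) ?_
  · have := hw t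
    exact (by fun_prop : Measurable fun p => Real.exp (-ℓ p - q p / t ^ 2) * w t p)
      |>.aestronglyMeasurable
  · filter_upwards [eventually_gt_atTop 0] with t ht
    refine (ae_restrict_iff' hT).2 (Eventually.of_forall fun p hp => ?_)
    rw [norm_mul, Real.norm_eq_abs, Real.norm_eq_abs, Real.abs_exp]
    have : 0 ≤ q p / t ^ 2 := div_nonneg (hq0 p hp) (by positivity)
    exact mul_le_mul (Real.exp_le_exp.2 (by linarith)) (hwb t ht p hp) (abs_nonneg _)
      (Real.exp_pos _).le
  · refine (ae_restrict_iff' hT).2 (Eventually.of_forall fun p hp => ?_)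
    refine Tendsto.mul ?_ (hwlim p hp)
    refine (Real.continuous_exp.tendsto _).comp ?_
    simpa using (tendsto_const_nhds (x := -ℓ p)).sub
      ((tendsto_const_nhds (x := q p)).div_atTop (tendsto_pow_atTop two_ne_zero))

lemma integral_exp_neg_mul_mul_const {k : ℝ} (hk : 0 < k) (W : ℝ) :
    ∫ a in Ioi (0 : ℝ), Real.exp (-(k * a)) * W = W / k := by
  have := integral_exp_mul_Ioi (a := -k) (by linarith) 0
  simp only [neg_mul, mul_zero, Real.exp_zero] at this
  rw [integral_mul_const, this]
  field_simp

lemma integrableOn_exp_neg_mul {k : ℝ} (hk : 0 < k) :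
    IntegrableOn (fun a : ℝ => Real.exp (-(k * a))) (Ioi 0) := by
  simpa using integrableOn_exp_mul_Ioi (a := -k) (by linarith) 0

/-! ### The standard normal distribution -/

lemma stdNormalPdf_pos (t : ℝ) : 0 < stdNormalPdf t := by
  unfold stdNormalPdf; positivity

lemma continuous_stdNormalPdf : Continuous stdNormalPdf := by
  unfold stdNormalPdf; fun_prop

lemma integrable_stdNormalPdf : Integrable stdNormalPdf := by
  unfold stdNormalPdf
  refine Integrable.const_mul ?_ _
  convert integrable_exp_neg_mul_sq (b := 1 / 2) (by norm_num) using 2 with t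
  ring_nf

lemma stdNormalCdf_nonneg (z : ℝ) : 0 ≤ stdNormalCdf z :=
  integral_nonneg fun t => (stdNormalPdf_pos t).le

lemma monotone_stdNormalCdf : Monotone stdNormalCdf := fun _ _ h =>
  setIntegral_mono_set integrable_stdNormalPdf.integrableOn
    (Eventually.of_forall fun t => (stdNormalPdf_pos t).le) (Iic_subset_Iic.2 h).eventuallyLE

lemma stdNormalCdf_le (z : ℝ) : stdNormalCdf z ≤ ∫ t, stdNormalPdf t :=
  setIntegral_le_integral integrable_stdNormalPdf
    (Eventually.of_forall fun t => (stdNormalPdf_pos t).le)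

/-- The ratio `Φ(-z) / φ(z)`. -/
noncomputable def millsRatio (z : ℝ) : ℝ :=
  Real.sqrt (2 * π) * Real.exp (z ^ 2 / 2) * stdNormalCdf (-z)

@[fun_prop]
lemma measurable_millsRatio : Measurable millsRatio := by
  have := monotone_stdNormalCdf.measurable
  unfold millsRatio; fun_prop

lemma stdNormalCdf_eq_millsRatio (z : ℝ) :
    stdNormalCdf z = (Real.sqrt (2 * π))⁻¹ * Real.exp (-z ^ 2 / 2) * millsRatio (-z) := by
  have h : Real.exp (-z ^ 2 / 2) * Real.exp ((-z) ^ 2 / 2) = 1 := by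
    rw [← Real.exp_add, ← Real.exp_zero]; ring_nf
  have h2 : Real.sqrt (2 * π) ≠ 0 := by positivity
  unfold millsRatio
  rw [neg_neg]
  linear_combination (-stdNormalCdf z) * h -
    stdNormalCdf z * Real.exp (-z ^ 2 / 2) * Real.exp ((-z) ^ 2 / 2) * inv_mul_cancel₀ h2

lemma millsRatio_nonneg (z : ℝ) : 0 ≤ millsRatio z :=
  mul_nonneg (by positivity) (stdNormalCdf_nonneg _)

lemma preimage_rescale_Iic {t : ℝ} (ht : 0 < t) :
    (fun a : ℝ => -t - t⁻¹ • a) ⁻¹' Iic (-t) = Ici 0 := by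
  ext a
  simp only [mem_preimage, mem_Iic, mem_Ici, smul_eq_mul]
  constructor
  · intro h
    have : 0 ≤ t⁻¹ * a := by linarith
    exact (mul_nonneg_iff_of_pos_left (by positivity)).1 this
  · intro h
    have : 0 ≤ t⁻¹ * a := by positivity
    linarith

lemma setIntegral_Iic_neg_eq (f : ℝ → ℝ) {t : ℝ} (ht : 0 < t) :
    ∫ x in Iic (-t), f x = t⁻¹ * ∫ a in Ioi (0 : ℝ), f (-t - t⁻¹ * a) := by
  rw [setIntegral_eq_inv_mul_setIntegral_rescale volume measurableSet_Iic f (-t) ht,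
    preimage_rescale_Iic ht, integral_Ici_eq_integral_Ioi]
  simp

lemma mul_millsRatio_eq {z : ℝ} (hz : 0 < z) :
    z * millsRatio z =
      ∫ a in Ioi (0 : ℝ), Real.exp (-(1 * a) - a ^ 2 / 2 / z ^ 2) * 1 := by
  have h2 : Real.sqrt (2 * π) ≠ 0 := by positivity
  unfold millsRatio stdNormalCdf
  rw [setIntegral_Iic_neg_eq _ hz]
  calc _ = Real.sqrt (2 * π) * Real.exp (z ^ 2 / 2) *
        ∫ a in Ioi (0 : ℝ), stdNormalPdf (-z - z⁻¹ * a) := by field_simp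
    _ = _ := by
      rw [← integral_const_mul]
      congr 1 with a
      have : Real.exp (-(1 * a) - a ^ 2 / 2 / z ^ 2) =
          Real.exp (z ^ 2 / 2) * Real.exp (-(-z - z⁻¹ * a) ^ 2 / 2) := by
        rw [← Real.exp_add]
        congr 1
        field_simp
        ring
      unfold stdNormalPdf
      rw [this]
      field_simp

lemma tendsto_mul_millsRatio : Tendsto (fun z => z * millsRatio z) atTop (nhds 1) := by
  have h := tendsto_setIntegral_exp_neg_mul (μ := volume) (T := Ioi (0 : ℝ)) measurableSet_Ioi
    (ℓ := fun a => 1 * a) (q := fun a => a ^ 2 / 2) (w := fun _ _ => 1) (W := 1)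
    (by fun_prop) (by fun_prop) (by fun_prop) (fun _ _ => by positivity) (by simp)
    (fun _ _ => tendsto_const_nhds) (integrableOn_exp_neg_mul one_pos)
  rw [integral_exp_neg_mul_mul_const one_pos, div_one] at h
  refine h.congr' ?_
  filter_upwards [eventually_gt_atTop 0] with z hz
  rw [mul_millsRatio_eq hz]

lemma mul_millsRatio_le {z : ℝ} (hz : 0 < z) : z * millsRatio z ≤ 1 := by
  have h := integral_exp_neg_mul_mul_const one_pos 1
  rw [div_one] at h
  refine (mul_millsRatio_eq hz).trans_le (le_of_le_of_eq ?_ h)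
  refine integral_mono_of_nonneg (Eventually.of_forall fun a => by positivity)
    ((integrableOn_exp_neg_mul one_pos).mul_const _) (Eventually.of_forall fun a => ?_)
  have : 0 ≤ a ^ 2 / 2 / z ^ 2 := by positivity
  simp only [mul_one]
  exact Real.exp_le_exp.2 (by linarith)

lemma abs_mul_millsRatio_le {k t a : ℝ} (hk : 0 < k) (ht : 0 < t) (ha : 0 ≤ a) :
    |t * millsRatio (k * (t + t⁻¹ * a))| ≤ 1 / k := by
  have hz : 0 < t + t⁻¹ * a := by positivity
  have h := mul_millsRatio_le (mul_pos hk hz)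
  have h0 := millsRatio_nonneg (k * (t + t⁻¹ * a))
  rw [abs_of_nonneg (mul_nonneg ht.le h0), le_div_iff₀ hk]
  have h1 : 0 ≤ t⁻¹ * a := by positivity
  nlinarith [mul_nonneg (mul_nonneg hk.le h1) h0]

lemma tendsto_mul_millsRatio_rescale {k : ℝ} (hk : 0 < k) (a : ℝ) :
    Tendsto (fun t => t * millsRatio (k * (t + t⁻¹ * a))) atTop (nhds (1 / k)) := by
  have hinv : Tendsto (fun t : ℝ => t⁻¹ * a) atTop (nhds 0) := by
    simpa using tendsto_inv_atTop_zero.mul_const a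
  have hz : Tendsto (fun t : ℝ => k * (t + t⁻¹ * a)) atTop atTop :=
    (tendsto_id.atTop_add hinv).const_mul_atTop hk
  have hr : Tendsto (fun t : ℝ => k * (1 + t⁻¹ * (t⁻¹ * a))) atTop (nhds k) := by
    simpa using ((tendsto_inv_atTop_zero.mul hinv).const_add 1).const_mul k
  refine ((tendsto_mul_millsRatio.comp hz).div hr hk.ne').congr' ?_
  filter_upwards [eventually_gt_atTop 0, hr.eventually_ne hk.ne', hz.eventually_gt_atTop 0]
    with t ht h1 h2
  simp only [Function.comp_apply, Pi.div_apply]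
  rw [div_eq_iff h1]
  field_simp

/-! ### Tail of the univariate skew normal distribution -/

lemma integrable_skewNormalPdf (l : ℝ) :
    Integrable fun t => 2 * stdNormalPdf t * stdNormalCdf (l * t) := by
  have h1 := monotone_stdNormalCdf.measurable
  refine (integrable_stdNormalPdf.const_mul 2).mul_bdd (c := ∫ t, stdNormalPdf t)
    (h1.comp (measurable_const_mul l)).aestronglyMeasurable (Eventually.of_forall fun t => ?_)
  rw [Real.norm_eq_abs, abs_of_nonneg (stdNormalCdf_nonneg _)]
  exact stdNormalCdf_le _

lemma monotone_skewNormalCdf (l : ℝ) : Monotone (skewNormalCdf l) := fun _ _ h =>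
  setIntegral_mono_set (integrable_skewNormalPdf l).integrableOn
    (Eventually.of_forall fun t =>
      mul_nonneg (by have := stdNormalPdf_pos t; positivity) (stdNormalCdf_nonneg _))
    (Iic_subset_Iic.2 h).eventuallyLE

lemma tendsto_skewNormalCdf_neg {l : ℝ} (hl : 0 < l) :
    Tendsto (fun t => skewNormalCdf l (-t) * t ^ 2 * Real.exp ((1 + l ^ 2) / 2 * t ^ 2)) atTop
      (nhds (1 / (π * l * (1 + l ^ 2)))) := by
  have hk : 0 < 1 + l ^ 2 := by positivity
  have h := tendsto_setIntegral_exp_neg_mul (μ := volume) (T := Ioi (0 : ℝ)) measurableSet_Ioi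
    (ℓ := fun a => (1 + l ^ 2) * a) (q := fun a => (1 + l ^ 2) / 2 * a ^ 2)
    (w := fun t a => t * millsRatio (l * (t + t⁻¹ * a))) (W := 1 / l)
    (by fun_prop) (by fun_prop) (by fun_prop) (fun _ _ => by positivity)
    (fun t ht a ha => abs_mul_millsRatio_le hl ht (le_of_lt ha))
    (fun a _ => tendsto_mul_millsRatio_rescale hl a) (integrableOn_exp_neg_mul hk)
  rw [integral_exp_neg_mul_mul_const hk] at h
  have h' := h.const_mul (1 / π)
  rw [show 1 / (π * l * (1 + l ^ 2)) = 1 / π * (1 / l / (1 + l ^ 2)) by field_simp]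
  refine h'.congr' ?_
  filter_upwards [eventually_gt_atTop 0] with t ht
  unfold skewNormalCdf
  rw [setIntegral_Iic_neg_eq _ ht]
  have e : ∀ I : ℝ, t⁻¹ * I * t ^ 2 * Real.exp ((1 + l ^ 2) / 2 * t ^ 2) =
    (t * Real.exp ((1 + l ^ 2) / 2 * t ^ 2)) * I := fun I => by field_simp
  rw [e, ← integral_const_mul, ← integral_const_mul]
  congr 1 with a
  have hexp : Real.exp (-((1 + l ^ 2) * a) - (1 + l ^ 2) / 2 * a ^ 2 / t ^ 2) =
      Real.exp ((1 + l ^ 2) / 2 * t ^ 2) * Real.exp (-(-t - t⁻¹ * a) ^ 2 / 2) *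
        Real.exp (-(l * (-t - t⁻¹ * a)) ^ 2 / 2) := by
    rw [← Real.exp_add, ← Real.exp_add]
    congr 1
    field_simp
    ring
  have hs : (Real.sqrt (2 * π))⁻¹ * (Real.sqrt (2 * π))⁻¹ = 1 / (2 * π) := by
    rw [← mul_inv, Real.mul_self_sqrt (by positivity), one_div]
  rw [stdNormalCdf_eq_millsRatio, stdNormalPdf, hexp,
    show -(l * (-t - t⁻¹ * a)) = l * (t + t⁻¹ * a) by ring]
  have : 1 / π = 2 * ((Real.sqrt (2 * π))⁻¹ * (Real.sqrt (2 * π))⁻¹) := by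
    rw [hs]; field_simp
  rw [this]
  ring

/-! ### Joint tail of the bivariate skew normal distribution -/

lemma preimage_rescale_Iic_prod {t : ℝ} (ht : 0 < t) :
    (fun p : ℝ × ℝ => (-t, -t) - t⁻¹ • p) ⁻¹' (Iic (-t) ×ˢ Iic (-t)) = Ici 0 ×ˢ Ici 0 := by
  rw [← preimage_rescale_Iic ht]
  rfl

lemma setIntegral_Iic_prod_Iic_neg_eq (f : ℝ × ℝ → ℝ) {t : ℝ} (ht : 0 < t) :
    ∫ p in Iic (-t) ×ˢ Iic (-t), f p = (t ^ 2)⁻¹ *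
      ∫ p in Ici (0 : ℝ) ×ˢ Ici (0 : ℝ), f (-t - t⁻¹ * p.1, -t - t⁻¹ * p.2) := by
  rw [setIntegral_eq_inv_mul_setIntegral_rescale volume
    (measurableSet_Iic.prod measurableSet_Iic) f (-t, -t) ht, preimage_rescale_Iic_prod ht]
  simp only [Module.finrank_prod, Module.finrank_self, Nat.reduceAdd]
  rfl

lemma integrableOn_exp_neg_mul_add {k : ℝ} (hk : 0 < k) :
    IntegrableOn (fun p : ℝ × ℝ => Real.exp (-(k * (p.1 + p.2)))) (Ici 0 ×ˢ Ici 0) := by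
  have h := (integrableOn_Ici_iff_integrableOn_Ioi (by simp)).2 (integrableOn_exp_neg_mul hk)
  have h2 := h.mul_prod h
  rw [Measure.prod_restrict] at h2
  refine h2.congr (Eventually.of_forall fun p => ?_)
  simp only
  rw [← Real.exp_add]
  ring_nf

lemma integral_exp_neg_mul_add_mul_const {k : ℝ} (hk : 0 < k) (W : ℝ) :
    ∫ p in Ici (0 : ℝ) ×ˢ Ici (0 : ℝ), Real.exp (-(k * (p.1 + p.2))) * W = W / k ^ 2 := by
  have h := setIntegral_prod_mul (μ := volume) (ν := volume)
    (fun a : ℝ => Real.exp (-(k * a))) (fun a : ℝ => Real.exp (-(k * a))) (Ici 0) (Ici 0)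
  have h1 := integral_exp_neg_mul_mul_const hk 1
  simp only [mul_one] at h1
  rw [integral_Ici_eq_integral_Ioi, h1] at h
  rw [integral_mul_const, Measure.volume_eq_prod]
  simp only [mul_add, neg_add, Real.exp_add]
  rw [h]
  field_simp

lemma tendsto_biSkewNormal_corner {θ ρ : ℝ} (hθ : 0 < θ) (hρ : -1 < ρ) (hρ' : ρ < 1) :
    Tendsto (fun t => (∫ p in Iic (-t) ×ˢ Iic (-t), biSkewNormalPdf θ ρ p) * t ^ 3 *
        Real.exp ((1 + 2 * θ ^ 2 * (1 + ρ)) / (1 + ρ) * t ^ 2)) atTop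
      (nhds ((π * Real.sqrt (1 - ρ ^ 2) * Real.sqrt (2 * π))⁻¹ *
        (1 / (2 * θ) / ((1 + 2 * θ ^ 2 * (1 + ρ)) / (1 + ρ)) ^ 2))) := by
  have hp : 0 < 1 + ρ := by linarith
  have hm : 0 < 1 - ρ := by linarith
  have hr : 1 - ρ ^ 2 = (1 + ρ) * (1 - ρ) := by ring
  have hr0 : 0 < 1 - ρ ^ 2 := by rw [hr]; positivity
  have hk : 0 < (1 + 2 * θ ^ 2 * (1 + ρ)) / (1 + ρ) := by positivity
  have h := tendsto_setIntegral_exp_neg_mul (μ := volume) (T := Ici (0 : ℝ) ×ˢ Ici (0 : ℝ))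
    (measurableSet_Ici.prod measurableSet_Ici)
    (ℓ := fun p => (1 + 2 * θ ^ 2 * (1 + ρ)) / (1 + ρ) * (p.1 + p.2))
    (q := fun p => (p.1 ^ 2 - 2 * ρ * p.1 * p.2 + p.2 ^ 2) / (2 * (1 - ρ ^ 2)) +
      (θ * (p.1 + p.2)) ^ 2 / 2)
    (w := fun t p => t * millsRatio (2 * θ * (t + t⁻¹ * ((p.1 + p.2) / 2)))) (W := 1 / (2 * θ))
    (by fun_prop) (by fun_prop) (by fun_prop)
    (fun p _ => by
      have : 0 ≤ p.1 ^ 2 - 2 * ρ * p.1 * p.2 + p.2 ^ 2 := by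
        nlinarith [sq_nonneg (p.1 - ρ * p.2), mul_nonneg hr0.le (sq_nonneg p.2)]
      positivity)
    (fun t ht p hp => abs_mul_millsRatio_le (by positivity) ht
      (by have h1 : 0 ≤ p.1 := hp.1
          have h2 : 0 ≤ p.2 := hp.2
          positivity))
    (fun p _ => tendsto_mul_millsRatio_rescale (by positivity) _)
    (integrableOn_exp_neg_mul_add hk)
  rw [integral_exp_neg_mul_add_mul_const hk] at h
  refine (h.const_mul _).congr' ?_
  filter_upwards [eventually_gt_atTop 0] with t ht
  rw [setIntegral_Iic_prod_Iic_neg_eq _ ht]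
  have e : ∀ I x : ℝ, (t ^ 2)⁻¹ * I * t ^ 3 * x = (t * x) * I := fun I x => by field_simp
  rw [e, ← integral_const_mul, ← integral_const_mul]
  congr 1 with p
  obtain ⟨a, b⟩ := p
  have hexp : Real.exp (-((1 + 2 * θ ^ 2 * (1 + ρ)) / (1 + ρ) * (a + b)) -
        ((a ^ 2 - 2 * ρ * a * b + b ^ 2) / (2 * (1 - ρ ^ 2)) + (θ * (a + b)) ^ 2 / 2) / t ^ 2) =
      Real.exp ((1 + 2 * θ ^ 2 * (1 + ρ)) / (1 + ρ) * t ^ 2) *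
        Real.exp (-((-t - t⁻¹ * a) ^ 2 - 2 * ρ * (-t - t⁻¹ * a) * (-t - t⁻¹ * b) +
          (-t - t⁻¹ * b) ^ 2) / (2 * (1 - ρ ^ 2))) *
        Real.exp (-(θ * (-t - t⁻¹ * a) + θ * (-t - t⁻¹ * b)) ^ 2 / 2) := by
    rw [← Real.exp_add, ← Real.exp_add, hr]
    congr 1
    field_simp
    ring
  simp only [biSkewNormalPdf, biNormalPdf]
  rw [stdNormalCdf_eq_millsRatio, hexp,
    show -(θ * (-t - t⁻¹ * a) + θ * (-t - t⁻¹ * b)) =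
      2 * θ * (t + t⁻¹ * ((a + b) / 2)) by ring]
  simp only [mul_inv]
  ring

/-! ### Combining the two tails -/

lemma tendsto_quantile_atBot {l : ℝ} (hl : 0 < l) {Q : ℝ → ℝ}
    (hQ : ∀ u ∈ Ioo (0 : ℝ) 1, skewNormalCdf l (Q u) = u) :
    Tendsto Q (nhdsWithin 0 (Ioi 0)) atBot := by
  refine tendsto_atBot.2 fun b => ?_
  have hpos := (tendsto_skewNormalCdf_neg hl).eventually_const_lt
    (show 0 < 1 / (π * l * (1 + l ^ 2)) by positivity)
  obtain ⟨t, ht, htb, ht0⟩ :=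
    (hpos.and ((eventually_ge_atTop (-b)).and (eventually_gt_atTop 0))).exists
  have hF : 0 < skewNormalCdf l (-t) := by
    have := pos_of_mul_pos_left ht (by positivity)
    exact pos_of_mul_pos_left this (by positivity)
  filter_upwards [Ioo_mem_nhdsGT hF, Ioo_mem_nhdsGT one_pos] with u hu hu1
  by_contra! hlt
  have := monotone_skewNormalCdf l (show -t ≤ Q u by linarith)
  rw [hQ u hu1] at this
  linarith [hu.2]

/-- If `F t * t ^ 2 * exp (c * t ^ 2) → A > 0` then `-log (F t) ~ c * t ^ 2`. -/
lemma tendsto_neg_log_div_sq {F : ℝ → ℝ} {A c : ℝ} (hA : 0 < A)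
    (hF : Tendsto (fun t => F t * t ^ 2 * Real.exp (c * t ^ 2)) atTop (nhds A)) :
    Tendsto (fun t => -Real.log (F t) / t ^ 2) atTop (nhds c) := by
  have h1 : Tendsto (fun t : ℝ => Real.log t / t ^ 2) atTop (nhds 0) := by
    have := (isLittleO_log_rpow_atTop (r := 2) two_pos).tendsto_div_nhds_zero
    simpa using this
  have h2 := (hF.log hA.ne').div_atTop (tendsto_pow_atTop (α := ℝ) two_ne_zero)
  have h3 := ((h1.const_mul 2).const_add c).sub h2
  simp only [mul_zero, add_zero, sub_zero] at h3
  refine h3.congr' ?_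
  filter_upwards [eventually_gt_atTop 0, hF.eventually_const_lt hA] with t ht hpos
  have hFt : 0 < F t :=
    pos_of_mul_pos_left (pos_of_mul_pos_left hpos (by positivity)) (by positivity)
  rw [Real.log_mul (by positivity) (by positivity), Real.log_mul hFt.ne' (by positivity),
    Real.log_exp, Real.log_pow]
  push_cast
  field_simp
  ring

lemma tendsto_div_rpow_of_tails {F J : ℝ → ℝ} {A B c b : ℝ} (hA : 0 < A) (hB : 0 < B) (hc : 0 < c)
    (hF : Tendsto (fun t => F t * t ^ 2 * Real.exp (c * t ^ 2)) atTop (nhds A))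
    (hJ : Tendsto (fun t => J t * t ^ 3 * Real.exp (c * (1 + b) * t ^ 2)) atTop (nhds B)) :
    Tendsto (fun t => J t / F t / (F t ^ b * (B * (A ^ (1 + b))⁻¹ * (c ^ (b - 1 / 2))⁻¹) *
      (-Real.log (F t)) ^ (b - 1 / 2))) atTop (nhds 1) := by
  have hL := tendsto_neg_log_div_sq hA hF
  have h1 := (hJ.div (hF.rpow_const (p := 1 + b) (Or.inl hA.ne')) (by positivity)).div
    (hL.rpow_const (p := b - 1 / 2) (Or.inl hc.ne')) (by positivity)
  have h2 := h1.div_const (B * (A ^ (1 + b))⁻¹ * (c ^ (b - 1 / 2))⁻¹)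
  have hone : B / A ^ (1 + b) / c ^ (b - 1 / 2) / (B * (A ^ (1 + b))⁻¹ * (c ^ (b - 1 / 2))⁻¹) =
      1 := by
    field_simp
  rw [hone] at h2
  refine h2.congr' ?_
  filter_upwards [eventually_gt_atTop 0, hF.eventually_const_lt hA, hL.eventually_const_lt hc]
    with t ht hpos hLpos
  have hFt : 0 < F t :=
    pos_of_mul_pos_left (pos_of_mul_pos_left hpos (by positivity)) (by positivity)
  have hLt : 0 < -Real.log (F t) := by
    rw [div_eq_mul_inv] at hLpos
    exact pos_of_mul_pos_left hLpos (by positivity)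
  simp only [Pi.div_apply]
  have e1 : (F t * t ^ 2 * Real.exp (c * t ^ 2)) ^ (1 + b) =
      F t * F t ^ b * t ^ 3 * (t ^ 2) ^ (b - 1 / 2) * Real.exp (c * (1 + b) * t ^ 2) := by
    have ht2 : (t ^ 2) ^ (1 + b) = t ^ 3 * (t ^ 2) ^ (b - 1 / 2) := by
      rw [← Real.rpow_natCast t 2, ← Real.rpow_natCast t 3, ← Real.rpow_mul ht.le,
        ← Real.rpow_mul ht.le, ← Real.rpow_add ht]
      congr 1
      push_cast
      ring
    rw [Real.mul_rpow (by positivity) (by positivity), Real.mul_rpow hFt.le (by positivity),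
      ← Real.exp_mul, Real.rpow_add hFt, Real.rpow_one, ht2,
      show c * t ^ 2 * (1 + b) = c * (1 + b) * t ^ 2 by ring]
    ring
  rw [e1, Real.div_rpow hLt.le (by positivity)]
  have := Real.rpow_pos_of_pos hLt (b - 1 / 2)
  have := Real.rpow_pos_of_pos hFt b
  field_simp

lemma tail_constant_eq {θ ρ l α β : ℝ} (hθ : 0 < θ) (hρ : -1 < ρ) (hρ' : ρ < 1)
    (hl : l = θ * (1 + ρ) / Real.sqrt (1 + θ ^ 2 * (1 - ρ ^ 2)))
    (hα : α = θ * (1 + ρ) / Real.sqrt (1 + 2 * θ ^ 2 * (1 + ρ)))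
    (hβ : β = Real.sqrt ((1 - ρ) * (1 + 2 * θ ^ 2 * (1 + ρ)) / (1 + ρ))) :
    (π * Real.sqrt (1 - ρ ^ 2) * Real.sqrt (2 * π))⁻¹ *
        (1 / (2 * θ) / ((1 + 2 * θ ^ 2 * (1 + ρ)) / (1 + ρ)) ^ 2) =
      α ^ 3 / (π * l ^ 4 * β * (1 + β ^ 2) ^ 2) * Real.sqrt (2 / π) := by
  have hp : 0 < 1 + ρ := by linarith
  have hm : 0 < 1 - ρ := by linarith
  have hB0 : 0 < 1 + θ ^ 2 * (1 - ρ ^ 2) := by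
    rw [show 1 - ρ ^ 2 = (1 + ρ) * (1 - ρ) by ring]; positivity
  have hA0 : 0 < 1 + 2 * θ ^ 2 * (1 + ρ) := by positivity
  have hb : β ^ 2 = (1 - ρ) * (1 + 2 * θ ^ 2 * (1 + ρ)) / (1 + ρ) := by
    rw [hβ, Real.sq_sqrt (by positivity)]
  have hb1 : 1 + β ^ 2 = 2 * (1 + θ ^ 2 * (1 - ρ ^ 2)) / (1 + ρ) := by
    rw [hb]; field_simp; ring
  have hl4 : l ^ 4 = (θ * (1 + ρ)) ^ 4 / (1 + θ ^ 2 * (1 - ρ ^ 2)) ^ 2 := by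
    rw [hl, div_pow, show ∀ x : ℝ, x ^ 4 = (x ^ 2) ^ 2 by intro x; ring,
      show ∀ x : ℝ, x ^ 4 = (x ^ 2) ^ 2 by intro x; ring, Real.sq_sqrt hB0.le]
  have hs : Real.sqrt (2 / π) = 2 / Real.sqrt (2 * π) := by
    rw [show 2 / π = 2 ^ 2 / (2 * π) by field_simp, Real.sqrt_div (by positivity),
      Real.sqrt_sq (by norm_num)]
  have hβ' : β = Real.sqrt (1 - ρ) * Real.sqrt (1 + 2 * θ ^ 2 * (1 + ρ)) / Real.sqrt (1 + ρ) := by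
    rw [hβ, Real.sqrt_div (by positivity), Real.sqrt_mul hm.le]
  have hr : Real.sqrt (1 - ρ ^ 2) = Real.sqrt (1 + ρ) * Real.sqrt (1 - ρ) := by
    rw [← Real.sqrt_mul hp.le]; ring_nf
  rw [hb1, hl4, hs, hr, hα, hβ']
  have qp := Real.sq_sqrt hp.le
  have qA := Real.sq_sqrt hA0.le
  have sp := Real.sqrt_pos.2 hp
  have sm := Real.sqrt_pos.2 hm
  have sA := Real.sqrt_pos.2 hA0
  set P := Real.sqrt (1 + ρ)
  set A := Real.sqrt (1 + 2 * θ ^ 2 * (1 + ρ))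
  set N := Real.sqrt (1 - ρ)
  set D := 1 + θ ^ 2 * (1 - ρ ^ 2)
  have sS : 0 < Real.sqrt (2 * π) := by positivity
  set S := Real.sqrt (2 * π)
  rw [← qA, ← qp]
  field_simp

/-- Rate of decay of lower tail dependence for the equi-skew bivariate skew normal, θ > 0:
λ_L(u) ~ u^{β²} (α³/(πλ⁴β(1+β²)²)) √(2/π) (2πλ)^{1+β²} ((1+λ²)/2)^{3/2} (-log u)^{β²-1/2}
as u → 0⁺. -/
theorem biSkewNormal_tail_dependence_pos (θ ρ : ℝ) (hθ : 0 < θ) (hρ : -1 < ρ) (hρ' : ρ < 1)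
    (l α β : ℝ)
    (hl : l = θ * (1 + ρ) / Real.sqrt (1 + θ ^ 2 * (1 - ρ ^ 2)))
    (hα : α = θ * (1 + ρ) / Real.sqrt (1 + 2 * θ ^ 2 * (1 + ρ)))
    (hβ : β = Real.sqrt ((1 - ρ) * (1 + 2 * θ ^ 2 * (1 + ρ)) / (1 + ρ)))
    (Q : ℝ → ℝ) (hQ : ∀ u ∈ Set.Ioo (0 : ℝ) 1, skewNormalCdf l (Q u) = u) :
    Tendsto (fun u : ℝ =>
      ((∫ p in {p : ℝ × ℝ | p.1 ≤ Q u ∧ p.2 ≤ Q u}, biSkewNormalPdf θ ρ p) / u) /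
      (u ^ (β ^ 2) * (α ^ 3 / (π * l ^ 4 * β * (1 + β ^ 2) ^ 2)) * Real.sqrt (2 / π) *
        (2 * π * l) ^ (1 + β ^ 2) * ((1 + l ^ 2) / 2) ^ ((3 : ℝ) / 2) *
        (-Real.log u) ^ (β ^ 2 - 1 / 2)))
      (nhdsWithin 0 (Set.Ioi 0)) (nhds 1) := by
  have hp : 0 < 1 + ρ := by linarith
  have hm : 0 < 1 - ρ := by linarith
  have hB0 : 0 < 1 + θ ^ 2 * (1 - ρ ^ 2) := by
    rw [show 1 - ρ ^ 2 = (1 + ρ) * (1 - ρ) by ring]; positivity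
  have hl0 : 0 < l := by rw [hl]; positivity
  have hb : β ^ 2 = (1 - ρ) * (1 + 2 * θ ^ 2 * (1 + ρ)) / (1 + ρ) := by
    rw [hβ, Real.sq_sqrt (by positivity)]
  have hl2 : l ^ 2 = (θ * (1 + ρ)) ^ 2 / (1 + θ ^ 2 * (1 - ρ ^ 2)) := by
    rw [hl, div_pow, Real.sq_sqrt hB0.le]
  have hκ : (1 + 2 * θ ^ 2 * (1 + ρ)) / (1 + ρ) = (1 + l ^ 2) / 2 * (1 + β ^ 2) := by
    rw [hb, hl2]; field_simp; ring
  have hJ := tendsto_biSkewNormal_corner hθ hρ hρ'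
  have hC : 0 < (π * Real.sqrt (1 - ρ ^ 2) * Real.sqrt (2 * π))⁻¹ *
      (1 / (2 * θ) / ((1 + 2 * θ ^ 2 * (1 + ρ)) / (1 + ρ)) ^ 2) := by
    have : 0 < 1 - ρ ^ 2 := by rw [show 1 - ρ ^ 2 = (1 + ρ) * (1 - ρ) by ring]; positivity
    positivity
  rw [tail_constant_eq hθ hρ hρ' hl hα hβ] at hJ hC
  rw [hκ] at hJ
  have hc : 0 < (1 + l ^ 2) / 2 := by positivity
  have hA : 0 < 1 / (π * l * (1 + l ^ 2)) := by positivity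
  have hmain := (tendsto_div_rpow_of_tails hA hC hc (tendsto_skewNormalCdf_neg hl0) hJ).comp
    (tendsto_neg_atBot_atTop.comp (tendsto_quantile_atBot hl0 hQ))
  refine hmain.congr' ?_
  have hK : (((1 : ℝ) / (π * l * (1 + l ^ 2))) ^ (1 + β ^ 2))⁻¹ *
      (((1 + l ^ 2) / 2) ^ (β ^ 2 - 1 / 2))⁻¹ =
      (2 * π * l) ^ (1 + β ^ 2) * ((1 + l ^ 2) / 2) ^ ((3 : ℝ) / 2) := by
    rw [← Real.inv_rpow hA.le, one_div, inv_inv,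
      show π * l * (1 + l ^ 2) = 2 * π * l * ((1 + l ^ 2) / 2) by ring,
      Real.mul_rpow (by positivity) hc.le, mul_assoc, ← Real.rpow_neg hc.le, ← Real.rpow_add hc]
    congr 2
    ring
  filter_upwards [Ioo_mem_nhdsGT one_pos] with u hu
  simp only [Function.comp_apply, neg_neg, hQ u hu]
  congr 2
  rw [mul_assoc (_ * Real.sqrt (2 / π)), hK]
  ring
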